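/- Let T_A be a positive random variable with E[T_A] = 1 and finite variance σ_A². For n ≥ 1 define η⁽ⁿ⁾(θ) as the unique real solution of e^θ · E[exp(−η⁽ⁿ⁾(θ)·min(T_A, n^{1/2}))] = 1. Then as n → ∞, for fixed θ, η⁽ⁿ⁾(n^{−1/2}θ) = n^{−1/2}θ + (1/2)σ_A² n^{−1}θ² + o(n^{−1}θ²). -/

import Mathlib

open MeasureTheory Filter

lemma aux_exp2 (u : ℝ) : |Real.exp u - 1 - u| ≤ |u| ^ 2 * Real.exp |u| := by
  have h := Complex.norm_exp_sub_sum_le_norm_mul_exp (u : ℂ) 2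
  simp only [Finset.sum_range_succ, Finset.sum_range_zero] at h
  have e : Complex.exp u - (0 + (u : ℂ) ^ 0 / (Nat.factorial 0 : ℂ) + (u : ℂ) ^ 1 / (Nat.factorial 1 : ℂ))
      = ((Real.exp u - 1 - u : ℝ) : ℂ) := by
    push_cast; simp; ring
  rw [e] at h
  simpa only [Complex.norm_real, Real.norm_eq_abs] using h

lemma aux_exp3 (u : ℝ) : |Real.exp u - 1 - u - u ^ 2 / 2| ≤ |u| ^ 3 * Real.exp |u| := by
  have h := Complex.norm_exp_sub_sum_le_norm_mul_exp (u : ℂ) 3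
  simp only [Finset.sum_range_succ, Finset.sum_range_zero] at h
  have e : Complex.exp u - (0 + (u : ℂ) ^ 0 / (Nat.factorial 0 : ℂ) + (u : ℂ) ^ 1 / (Nat.factorial 1 : ℂ)
        + (u : ℂ) ^ 2 / (Nat.factorial 2 : ℂ))
      = ((Real.exp u - 1 - u - u ^ 2 / 2 : ℝ) : ℂ) := by
    push_cast; simp; ring
  rw [e] at h
  simpa only [Complex.norm_real, Real.norm_eq_abs] using h

lemma aux_sqrt_tendsto : Tendsto (fun n : ℕ => Real.sqrt n) atTop atTop :=
  Real.tendsto_sqrt_atTop.comp tendsto_natCast_atTop_atTop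

lemma aux_point (v : ℕ → ℝ) (a : ℝ) (hv : Tendsto v atTop (nhds a)) :
    Tendsto (fun n : ℕ => (n : ℝ) * (Real.exp (-(v n / Real.sqrt n)) - 1 + v n / Real.sqrt n))
      atTop (nhds (a ^ 2 / 2)) := by
  have hinv : Tendsto (fun n : ℕ => (Real.sqrt n)⁻¹) atTop (nhds 0) :=
    tendsto_inv_atTop_zero.comp aux_sqrt_tendsto
  have hb : Tendsto (fun n : ℕ => |v n| ^ 3 * (Real.sqrt n)⁻¹ * Real.exp |v n * (Real.sqrt n)⁻¹|)
      atTop (nhds 0) := by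
    have h1 := ((hv.abs.pow 3).mul hinv).mul
      ((Real.continuous_exp.tendsto _).comp (hv.mul hinv).abs)
    simpa using h1
  have hd : Tendsto (fun n : ℕ => (n : ℝ) * (Real.exp (-(v n / Real.sqrt n)) - 1 + v n / Real.sqrt n)
      - v n ^ 2 / 2) atTop (nhds 0) := by
    refine squeeze_zero_norm' ?_ hb
    filter_upwards [eventually_ge_atTop 1] with n hn
    have hn0 : (0 : ℝ) < n := by exact_mod_cast hn
    have hs : 0 < Real.sqrt n := Real.sqrt_pos.2 hn0
    have hss : Real.sqrt n ^ 2 = n := Real.sq_sqrt hn0.le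
    have h := aux_exp3 (-(v n / Real.sqrt n))
    set s := Real.sqrt n with hsdef
    have e : (n : ℝ) * (Real.exp (-(v n / s)) - 1 + v n / s) - v n ^ 2 / 2
        = s ^ 2 * (Real.exp (-(v n / s)) - 1 - (-(v n / s)) - (-(v n / s)) ^ 2 / 2) := by
      rw [← hss]; field_simp; ring
    rw [e, Real.norm_eq_abs, abs_mul, abs_of_pos (pow_pos hs 2)]
    refine (mul_le_mul_of_nonneg_left h (pow_pos hs 2).le).trans (le_of_eq ?_)
    rw [abs_neg, ← div_eq_mul_inv (v n) s, abs_div, abs_of_pos hs]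
    field_simp
  have := hd.add ((hv.pow 2).div_const 2)
  simpa using this

lemma aux_bound (s t x M : ℝ) (hs : 0 < s) (ht : 0 < t) (hx : |x| ≤ M) :
    |s ^ 2 * (Real.exp (-(x / s) * min t s) - 1 + x * t / s)|
      ≤ (M ^ 2 * Real.exp M + M) * t ^ 2 := by
  have hM : 0 ≤ M := (abs_nonneg x).trans hx
  set y := min t s with hy
  have hy0 : 0 < y := lt_min ht hs
  have hyt : y ≤ t := min_le_left _ _
  have hys : y ≤ s := min_le_right _ _
  have e : s ^ 2 * (Real.exp (-(x / s) * y) - 1 + x * t / s)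
      = s ^ 2 * (Real.exp (-(x / s) * y) - 1 - (-(x / s) * y)) + x * (s * (t - y)) := by
    field_simp; ring
  have hu : |-(x / s) * y| = |x| * y / s := by
    rw [abs_mul, abs_neg, abs_div, abs_of_pos hs, abs_of_pos hy0]; ring
  have hu2 : |x| * y / s ≤ M := by
    rw [div_le_iff₀ hs]; exact mul_le_mul hx hys hy0.le hM
  have h1 := aux_exp2 (-(x / s) * y)
  rw [hu] at h1
  have h2 : s ^ 2 * |Real.exp (-(x / s) * y) - 1 - (-(x / s) * y)| ≤ M ^ 2 * Real.exp M * t ^ 2 := by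
    calc _ ≤ s ^ 2 * ((|x| * y / s) ^ 2 * Real.exp (|x| * y / s)) := by gcongr
      _ = |x| ^ 2 * y ^ 2 * Real.exp (|x| * y / s) := by field_simp
      _ ≤ M ^ 2 * t ^ 2 * Real.exp M := by gcongr
      _ = _ := by ring
  have h3 : s * (t - y) ≤ t ^ 2 := by
    rcases le_total t s with h | h
    · rw [hy, min_eq_left h]; simp; positivity
    · rw [hy, min_eq_right h]; nlinarith
  have h3' : 0 ≤ s * (t - y) := mul_nonneg hs.le (by linarith)
  rw [e]
  refine (abs_add_le _ _).trans ?_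
  rw [abs_mul, abs_mul x, abs_of_pos (pow_pos hs 2), abs_of_nonneg h3', add_mul]
  exact add_le_add h2 (mul_le_mul hx h3 h3' hM)

lemma aux_main {Ω : Type*} [MeasurableSpace Ω] (μ : Measure Ω) [IsProbabilityMeasure μ]
    (T : Ω → ℝ) (hTmeas : Measurable T) (hTpos : ∀ ω, 0 < T ω)
    (hT : Integrable T μ) (hTT : Integrable (fun ω => T ω ^ 2) μ)
    (hTmean : ∫ ω, T ω ∂μ = 1) (x : ℕ → ℝ) (a : ℝ) (hx : Tendsto x atTop (nhds a)) :
    Tendsto (fun n : ℕ => (n : ℝ) *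
      ((∫ ω, Real.exp (-(x n / Real.sqrt n) * min (T ω) (Real.sqrt n)) ∂μ) - 1 + x n / Real.sqrt n))
      atTop (nhds (a ^ 2 / 2 * ∫ ω, T ω ^ 2 ∂μ)) := by
  have hdct : Tendsto (fun n : ℕ => ∫ ω, (Real.sqrt n) ^ 2 *
      (Real.exp (-(x n / Real.sqrt n) * min (T ω) (Real.sqrt n)) - 1 + x n * T ω / Real.sqrt n) ∂μ)
      atTop (nhds (∫ ω, a ^ 2 / 2 * T ω ^ 2 ∂μ)) := by
    have hM : ∀ᶠ n in atTop, |x n| ≤ |a| + 1 := by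
      filter_upwards [hx.abs.eventually_lt_const (lt_add_one |a|)] with n hn using hn.le
    refine tendsto_integral_filter_of_dominated_convergence
      (fun ω => ((|a| + 1) ^ 2 * Real.exp (|a| + 1) + (|a| + 1)) * T ω ^ 2) ?_ ?_
      (hTT.const_mul _) ?_
    · refine Eventually.of_forall fun n => Measurable.aestronglyMeasurable ?_
      fun_prop
    · filter_upwards [hM, eventually_ge_atTop 1] with n hn hn1
      refine Eventually.of_forall fun ω => ?_
      exact aux_bound _ _ _ _ (Real.sqrt_pos.2 (by exact_mod_cast hn1)) (hTpos ω) hn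
    · refine Eventually.of_forall fun ω => ?_
      have h := aux_point (fun n => x n * T ω) (a * T ω) (hx.mul_const _)
      rw [show a ^ 2 / 2 * T ω ^ 2 = (a * T ω) ^ 2 / 2 by ring]
      refine h.congr' ?_
      filter_upwards [aux_sqrt_tendsto.eventually_ge_atTop (T ω)] with n hn
      rw [min_eq_left hn, Real.sq_sqrt (Nat.cast_nonneg n)]
      congr 4
      ring
  rw [integral_const_mul] at hdct
  refine hdct.congr' ?_
  filter_upwards [eventually_ge_atTop 1] with n hn
  have hs : 0 < Real.sqrt n := Real.sqrt_pos.2 (by exact_mod_cast hn)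
  have hi : Integrable (fun ω => Real.exp (-(x n / Real.sqrt n) * min (T ω) (Real.sqrt n))) μ := by
    refine Integrable.of_bound (C := Real.exp |x n|)
      (Measurable.aestronglyMeasurable (by fun_prop)) (Eventually.of_forall fun ω => ?_)
    rw [Real.norm_eq_abs, Real.abs_exp, Real.exp_le_exp]
    refine (le_abs_self _).trans ?_
    have h0 : 0 < min (T ω) (Real.sqrt n) := lt_min (hTpos ω) hs
    rw [abs_mul, abs_neg, abs_div, abs_of_pos hs, abs_of_pos h0, div_mul_eq_mul_div, div_le_iff₀ hs]
    gcongr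
    exact min_le_right _ _
  have hi2 : Integrable
      (fun ω => Real.exp (-(x n / Real.sqrt n) * min (T ω) (Real.sqrt n)) - 1) μ :=
    hi.sub (integrable_const _)
  rw [integral_const_mul, Real.sq_sqrt (Nat.cast_nonneg n),
    integral_add hi2 ((hT.const_mul _).div_const _),
    integral_sub hi (integrable_const _), integral_div, integral_const_mul, hTmean]
  simp

lemma aux_first (f : ℕ → ℝ) (v : ℝ) (b : ℝ)
    (h : Tendsto (fun n : ℕ => (n : ℝ) * (f n - 1 + v / Real.sqrt n)) atTop (nhds b)) :
    Tendsto (fun n : ℕ => Real.sqrt n * (1 - f n)) atTop (nhds v) := by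
  have hinv : Tendsto (fun n : ℕ => (Real.sqrt n)⁻¹) atTop (nhds 0) :=
    tendsto_inv_atTop_zero.comp aux_sqrt_tendsto
  have h2 := (h.mul hinv).const_sub v
  rw [mul_zero, sub_zero] at h2
  refine h2.congr' ?_
  filter_upwards [eventually_ge_atTop 1] with n hn
  have hn0 : (0 : ℝ) < n := by exact_mod_cast hn
  have hs : 0 < Real.sqrt n := Real.sqrt_pos.2 hn0
  have hss : Real.sqrt n ^ 2 = n := Real.sq_sqrt hn0.le
  set s := Real.sqrt n with hsdef
  rw [← hss]; field_simp; ring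

theorem stmt6 {Ω : Type*} [MeasurableSpace Ω] (μ : Measure Ω) [IsProbabilityMeasure μ]
    (T : Ω → ℝ) (hTmeas : Measurable T) (hTpos : ∀ ω, 0 < T ω)
    (hTmean : ∫ ω, T ω ∂μ = 1)
    (σA : ℝ) (hσA : σA ^ 2 = ∫ ω, (T ω - 1) ^ 2 ∂μ)
    (hT2 : Integrable (fun ω => (T ω - 1) ^ 2) μ)
    (η : ℕ → ℝ → ℝ)
    (hη : ∀ (n : ℕ) (θ : ℝ), 1 ≤ n →
      Real.exp θ * ∫ ω, Real.exp (-(η n θ) * min (T ω) (Real.sqrt n)) ∂μ = 1)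
    (θ : ℝ) :
    Tendsto
      (fun n : ℕ =>
        (n : ℝ) *
          (η n (θ / Real.sqrt n) - θ / Real.sqrt n - σA ^ 2 * θ ^ 2 / (2 * n)))
      atTop (nhds 0) := by
  have hT : Integrable T μ := by
    by_contra h
    rw [integral_undef h] at hTmean
    exact zero_ne_one hTmean
  have eT : (fun ω => T ω ^ 2) = fun ω => (T ω - 1) ^ 2 + (2 * T ω - 1) := by
    funext ω; ring
  have hL : Integrable (fun ω => 2 * T ω - 1) μ := (hT.const_mul 2).sub (integrable_const _)
  have hTT : Integrable (fun ω => T ω ^ 2) μ := by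
    rw [eT]; exact hT2.add hL
  have hm2 : ∫ ω, T ω ^ 2 ∂μ = σA ^ 2 + 1 := by
    rw [eT, integral_add hT2 hL, ← hσA, integral_sub (hT.const_mul 2) (integrable_const _),
      integral_const_mul, hTmean]
    simp; norm_num
  set x : ℕ → ℝ := fun n => Real.sqrt n * η n (θ / Real.sqrt n) with hxdef
  set G : ℕ → ℝ → ℝ := fun n c =>
    ∫ ω, Real.exp (-(c / Real.sqrt n) * min (T ω) (Real.sqrt n)) ∂μ with hG
  have hspos : ∀ n : ℕ, 1 ≤ n → 0 < Real.sqrt n := fun n hn =>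
    Real.sqrt_pos.2 (by exact_mod_cast hn)
  have hxs : ∀ n : ℕ, 1 ≤ n → x n / Real.sqrt n = η n (θ / Real.sqrt n) := fun n hn => by
    have := hspos n hn
    simp only [hxdef]; field_simp
  have hGx : ∀ n : ℕ, 1 ≤ n → G n (x n) = Real.exp (-(θ / Real.sqrt n)) := fun n hn => by
    have h := hη n (θ / Real.sqrt n) hn
    simp only [hG]
    rw [hxs n hn, Real.exp_neg]
    exact eq_inv_of_mul_eq_one_right h
  have hint : ∀ n : ℕ, 1 ≤ n → ∀ c : ℝ, Integrable
      (fun ω => Real.exp (-(c / Real.sqrt n) * min (T ω) (Real.sqrt n))) μ := fun n hn c => by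
    have hs := hspos n hn
    refine Integrable.of_bound (C := Real.exp |c|)
      (Measurable.aestronglyMeasurable (by fun_prop)) (Eventually.of_forall fun ω => ?_)
    rw [Real.norm_eq_abs, Real.abs_exp, Real.exp_le_exp]
    refine (le_abs_self _).trans ?_
    have h0 : 0 < min (T ω) (Real.sqrt n) := lt_min (hTpos ω) hs
    rw [abs_mul, abs_neg, abs_div, abs_of_pos hs, abs_of_pos h0, div_mul_eq_mul_div, div_le_iff₀ hs]
    gcongr
    exact min_le_right _ _
  have hanti : ∀ n : ℕ, 1 ≤ n → ∀ c d : ℝ, c ≤ d → G n d ≤ G n c := fun n hn c d hcd => by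
    have hs := hspos n hn
    refine integral_mono (hint n hn d) (hint n hn c) fun ω => ?_
    have h0 : 0 < min (T ω) (Real.sqrt n) := lt_min (hTpos ω) hs
    simp only
    gcongr
  have hexp := aux_point (fun _ => θ) θ tendsto_const_nhds
  have hexp1 := aux_first _ _ _ hexp
  have hfix : ∀ c : ℝ, Tendsto (fun n : ℕ => Real.sqrt n * (1 - G n c)) atTop (nhds c) := fun c =>
    aux_first _ _ _ (aux_main μ T hTmeas hTpos hT hTT hTmean (fun _ => c) c tendsto_const_nhds)
  have hxt : Tendsto x atTop (nhds θ) := by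
    rw [tendsto_order]
    constructor
    · intro c hc
      filter_upwards [(hfix c).eventually_lt hexp1 hc, eventually_ge_atTop 1] with n hn hn1
      by_contra hcon
      push Not at hcon
      have h := hanti n hn1 _ _ hcon
      rw [hGx n hn1] at h
      have := lt_of_mul_lt_mul_left hn (hspos n hn1).le
      linarith
    · intro c hc
      filter_upwards [hexp1.eventually_lt (hfix c) hc, eventually_ge_atTop 1] with n hn hn1
      by_contra hcon
      push Not at hcon
      have h := hanti n hn1 _ _ hcon
      rw [hGx n hn1] at h
      have := lt_of_mul_lt_mul_left hn (hspos n hn1).le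
      linarith
  have hfin := aux_main μ T hTmeas hTpos hT hTT hTmean x θ hxt
  have h := (hfin.sub hexp).sub_const (σA ^ 2 * θ ^ 2 / 2)
  rw [hm2] at h
  rw [show θ ^ 2 / 2 * (σA ^ 2 + 1) - θ ^ 2 / 2 - σA ^ 2 * θ ^ 2 / 2 = 0 by ring] at h
  refine h.congr' ?_
  filter_upwards [eventually_ge_atTop 1] with n hn
  have hg := hGx n hn
  simp only [hG] at hg
  rw [hg, hxs n hn]
  have hn0 : (n : ℝ) ≠ 0 := by positivity
  have e : σA ^ 2 * θ ^ 2 / 2 = n * (σA ^ 2 * θ ^ 2 / (2 * n)) := by field_simp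
  rw [e]; ring
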